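/- Let m ≥ 1 and α₁,…,α_m ∈ ℝ satisfy liminf_{n→∞} n‖nα₁‖⋯‖nα_m‖ > 0 (n ranging over positive integers). Then there exists a constant c > 0 such that for all positive integers N₁,…,N_m and all integer vectors n, n' ∈ ℤ^m with |nᵢ| ≤ Nᵢ and |n'ᵢ| ≤ Nᵢ for all i, if Σᵢ nᵢαᵢ and Σᵢ n'ᵢαᵢ are not congruent modulo 1, then ‖Σᵢ (nᵢ − n'ᵢ)αᵢ‖ > c/(N₁⋯N_m). -/

import Mathlib

noncomputable section

open MeasureTheory Set Filter

/-- The distance from a real number to the nearest integer. -/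
def distInt (x : ℝ) : ℝ := |x - round x|

/-- The real vector in `ℝ^k` corresponding to an integer vector. -/
def intVec {k : ℕ} (n : Fin k → ℤ) : Fin k → ℝ := fun i => (n i : ℝ)

/-- The embedding of `ℝ^d` into `ℝ^k` as the span of the first `d` coordinates. -/
def emb (k d : ℕ) (x : Fin d → ℝ) : Fin k → ℝ :=
  fun i => if h : (i : ℕ) < d then x ⟨i, h⟩ else 0

/-- A `k` to `d` cut and project scheme: a totally irrational `d`-dimensional subspace
`E ⊆ ℝ^k`, the projection `proj = π` onto `E` along a complementary subspace `F_π`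
(injective on `ℤ^k`), the projection `rho = ρ` onto `E` with respect to the decomposition
`ℝ^k = E + F_ρ` where `F_ρ = {0} × ℝ^{k-d}`, a window `W ⊆ F_ρ`, and a point `s`
(a representative of a point of `ℝ^k/ℤ^k`). -/
structure CPS (k d : ℕ) where
  E : Submodule ℝ (Fin k → ℝ)
  rank_E : Module.finrank ℝ E = d
  /-- `E` is totally irrational: its image in `ℝ^k/ℤ^k` is dense,
  equivalently `E + ℤ^k` is dense in `ℝ^k`. -/
  totallyIrrational : Dense {x : Fin k → ℝ | ∃ e ∈ E, ∃ n : Fin k → ℤ, x = e + intVec n}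
  /-- `π`, the projection onto `E` along a complementary subspace `F_π = ker proj`. -/
  proj : (Fin k → ℝ) →ₗ[ℝ] (Fin k → ℝ)
  proj_mem : ∀ x, proj x ∈ E
  proj_id : ∀ x ∈ E, proj x = x
  /-- `π` is injective on `ℤ^k`. -/
  proj_inj : ∀ m n : Fin k → ℤ, proj (intVec m) = proj (intVec n) → m = n
  /-- `ρ`, the projection onto `E` with respect to the decomposition `ℝ^k = E + F_ρ`. -/
  rho : (Fin k → ℝ) →ₗ[ℝ] (Fin k → ℝ)
  rho_mem : ∀ x, rho x ∈ E
  /-- `x - ρ(x) ∈ F_ρ = {0} × ℝ^{k-d}`; in particular `ρ* = id - ρ` maps into `F_ρ`. -/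
  rho_decomp : ∀ (x : Fin k → ℝ) (i : Fin k), (i : ℕ) < d → x i - rho x i = 0
  /-- The window `W ⊆ F_ρ`. -/
  window : Set (Fin k → ℝ)
  window_sub : ∀ x ∈ window, ∀ i : Fin k, (i : ℕ) < d → x i = 0
  /-- A representative of the point `s ∈ ℝ^k/ℤ^k`. -/
  s : Fin k → ℝ

namespace CPS

variable {k d : ℕ} (𝒟 : CPS k d)

/-- `ρ* : ℝ^k → F_ρ`, the projection onto `F_ρ` along `E`. -/
def rhoStar (x : Fin k → ℝ) : Fin k → ℝ := x - 𝒟.rho x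

/-- The strip `S = W + E`. -/
def strip : Set (Fin k → ℝ) := {z | ∃ w ∈ 𝒟.window, ∃ e ∈ (𝒟.E : Set (Fin k → ℝ)), z = w + e}

/-- The cut and project set `Y = π(S ∩ (ℤ^k + s))`. -/
def Y : Set (Fin k → ℝ) :=
  𝒟.proj '' (𝒟.strip ∩ {z | ∃ n : Fin k → ℤ, z = intVec n + 𝒟.s})

/-- `s` is regular: `ℤ^k + s` does not meet the boundary of the strip. -/
def Regular : Prop := ∀ n : Fin k → ℤ, intVec n + 𝒟.s ∉ frontier 𝒟.strip

/-- `Y` is aperiodic: its group of periods is trivial. -/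
def Aperiodic : Prop := ∀ x ∈ (𝒟.E : Set (Fin k → ℝ)),
  {z | ∃ y ∈ 𝒟.Y, z = y + x} = 𝒟.Y → x = 0

/-- The window is the cubical window `{Σ_{i=d+1}^k t_i e_i : 0 ≤ t_i < 1}`. -/
def IsCubical : Prop :=
  𝒟.window = {x : Fin k → ℝ | ∀ i : Fin k,
    if (i : ℕ) < d then x i = 0 else 0 ≤ x i ∧ x i < 1}

/-- The window is the canonical window `ρ*([0,1]^k)`. -/
def IsCanonical : Prop :=
  𝒟.window = 𝒟.rhoStar '' {x : Fin k → ℝ | ∀ i, x i ∈ Icc (0 : ℝ) 1}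

/-- `Y` is a cubical cut and project set: totally irrational (a field of `CPS`),
regular, aperiodic, and formed with the cubical window. -/
def IsCubicalCPSet : Prop := 𝒟.IsCubical ∧ 𝒟.Regular ∧ 𝒟.Aperiodic

/-- `Y` is a canonical cut and project set. -/
def IsCanonicalCPSet : Prop := 𝒟.IsCanonical ∧ 𝒟.Regular ∧ 𝒟.Aperiodic

/-- For `y ∈ Y`, the (unique, by injectivity of `π` on `ℤ^k`) integer vector `ỹ`
with `ỹ + s ∈ S` and `π(ỹ + s) = y`. -/
def intRep (y : Fin k → ℝ) : Fin k → ℤ :=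
  Classical.epsilon fun n : Fin k → ℤ =>
    intVec n + 𝒟.s ∈ 𝒟.strip ∧ 𝒟.proj (intVec n + 𝒟.s) = y

/-- The patch of shape `Ω` at `y`: `P(y,Ω) = {y' ∈ Y : ρ(ỹ' - ỹ) ∈ ρ(Ω)}`,
where `Ω ⊆ ℝ^d` is viewed inside `⟨e₁,…,e_d⟩_ℝ ⊆ ℝ^k`. -/
def patch (Ω : Set (Fin d → ℝ)) (y : Fin k → ℝ) : Set (Fin k → ℝ) :=
  {y' | y' ∈ 𝒟.Y ∧
    𝒟.rho (intVec (𝒟.intRep y') - intVec (𝒟.intRep y)) ∈ 𝒟.rho '' (emb k d '' Ω)}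

/-- Two patches of shape `Ω` are equivalent if they agree up to the translation
taking one distinguished point to the other. -/
def PatchEquiv (Ω : Set (Fin d → ℝ)) (y₁ y₂ : Fin k → ℝ) : Prop :=
  𝒟.patch Ω y₁ = {z | ∃ w ∈ 𝒟.patch Ω y₂, z = w + (y₁ - y₂)}

/-- The pattern (equivalence class) of the patch of shape `Ω` at `y` occurs in the
region `R ⊆ E`: some point `y' ∈ Y ∩ R` has patch equivalent to that at `y`. -/
def OccursIn (Ω : Set (Fin d → ℝ)) (y : Fin k → ℝ) (R : Set (Fin k → ℝ)) : Prop :=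
  ∃ y' ∈ 𝒟.Y ∩ R, 𝒟.PatchEquiv Ω y' y

/-- `Y` is linearly repetitive with respect to a collection `𝒜` of shapes in `ℝ^d`:
there is `C > 0` such that for every `Ω ∈ 𝒜`, every pattern of shape `Ω` occurring in
`Y` occurs in every ball in `E` of volume `C·|Ω|` (balls in `E` being images under the
identification `ρ ∘ emb : ℝ^d ≅ E` of balls in `ℝ^d`). -/
def IsLR (𝒜 : Set (Set (Fin d → ℝ))) : Prop :=
  ∃ C > (0 : ℝ), ∀ Ω ∈ 𝒜, ∀ y ∈ 𝒟.Y, ∀ (x : Fin d → ℝ) (r : ℝ),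
    volume (Metric.closedBall x r) = ENNReal.ofReal C * volume Ω →
    𝒟.OccursIn Ω y (𝒟.rho '' (emb k d '' Metric.closedBall x r))

/-- `Y` is `LR_Ω` with respect to a collection `𝒜` of shapes in `ℝ^d`: there is `C > 0`
such that for every `Ω ∈ 𝒜`, every pattern of shape `Ω` occurring in `Y` occurs in every
translate of `C·Ω`. -/
def IsLROmega (𝒜 : Set (Set (Fin d → ℝ))) : Prop :=
  ∃ C > (0 : ℝ), ∀ Ω ∈ 𝒜, ∀ y ∈ 𝒟.Y, ∀ x : Fin d → ℝ,
    𝒟.OccursIn Ω y (𝒟.rho '' (emb k d '' {z | ∃ w ∈ Ω, z = x + C • w}))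

end CPS

/-- `ℛ_d`: aligned rectangles in `ℝ^d` with integer vertices and nonempty interior. -/
def RdCollection (d : ℕ) : Set (Set (Fin d → ℝ)) :=
  {Ω | ∃ a b : Fin d → ℤ, (∀ i, a i < b i) ∧
    Ω = {x : Fin d → ℝ | ∀ i, (a i : ℝ) ≤ x i ∧ x i ≤ (b i : ℝ)}}

/-- `𝒞_d`: convex polytopes in `ℝ^d` with vertices in `ℤ^d` and nonempty interior. -/
def CdCollection (d : ℕ) : Set (Set (Fin d → ℝ)) :=
  {Ω | (∃ V : Finset (Fin d → ℤ),
      Ω = convexHull ℝ ((fun n : Fin d → ℤ => intVec n) '' (V : Set (Fin d → ℤ)))) ∧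
    (interior Ω).Nonempty}

lemma minkowski_forms {ι : Type*} [Fintype ι] [DecidableEq ι] (A : Matrix ι ι ℝ)
    (hA : A.det ≠ 0) (δ : ι → ℝ) (hδ : ∀ i, 0 < δ i) (hd : |A.det| < ∏ i, δ i) :
    ∃ z : ι → ℤ, z ≠ 0 ∧ ∀ i, |A.mulVec (fun j => (z j : ℝ)) i| < δ i := by
  set b := Pi.basisFun ℝ ι with hb
  set s : Set (ι → ℝ) := Matrix.toLin' A ⁻¹' (pi univ fun i => Ioo (-δ i) (δ i)) with hs
  have hmem : ∀ x, x ∈ s ↔ ∀ i, |A.mulVec x i| < δ i := by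
    intro x
    simp [hs, abs_lt, Set.mem_pi]
  have hsymm : ∀ x ∈ s, -x ∈ s := by
    intro x hx
    rw [hmem] at hx ⊢
    intro i
    rw [Matrix.mulVec_neg, Pi.neg_apply, abs_neg]
    exact hx i
  have hconv : Convex ℝ s :=
    Convex.linear_preimage (convex_pi fun i _ => convex_Ioo _ _) _
  have hvol : volume (ZSpan.fundamentalDomain b) * 2 ^ Module.finrank ℝ (ι → ℝ) < volume s := by
    rw [hs, Measure.addHaar_preimage_linearMap volume (by rwa [LinearMap.det_toLin']),
      LinearMap.det_toLin', hb, ZSpan.fundamentalDomain_pi_basisFun, Real.volume_pi_Ioo,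
      volume_pi, Measure.pi_pi, ← ENNReal.ofReal_prod_of_nonneg (fun i _ => by linarith [hδ i]),
      ← ENNReal.ofReal_mul (abs_nonneg _)]
    have h1 : ∏ i, (δ i - -δ i) = 2 ^ Fintype.card ι * ∏ i, δ i := by
      rw [Fintype.card, ← Finset.prod_const, ← Finset.prod_mul_distrib]
      exact Finset.prod_congr rfl fun i _ => by ring
    have h2 : (2 : ENNReal) ^ Fintype.card ι = ENNReal.ofReal (2 ^ Fintype.card ι) := by
      rw [ENNReal.ofReal_pow (by norm_num)]; simp
    simp only [Real.volume_Ico, sub_zero, ENNReal.ofReal_one, Finset.prod_const_one, one_mul,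
      Module.finrank_fintype_fun_eq_card]
    rw [h1, h2]
    have hp : 0 < |A.det| := abs_pos.2 hA
    have h3 : (2 : ℝ) ^ Fintype.card ι <
        |A.det⁻¹| * (2 ^ Fintype.card ι * ∏ i, δ i) := by
      rw [abs_inv, inv_mul_eq_div, lt_div_iff₀ hp]
      gcongr
    exact (ENNReal.ofReal_lt_ofReal_iff (lt_trans (by positivity) h3)).2 h3
  have : Countable (Submodule.span ℤ (Set.range b)).toAddSubgroup :=
    inferInstanceAs (Countable (Submodule.span ℤ (Set.range b)))
  obtain ⟨x, hx0, hxs⟩ := exists_ne_zero_mem_lattice_of_measure_mul_two_pow_lt_measure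
    (ZSpan.isAddFundamentalDomain' b volume) hsymm hconv hvol
  have hx := x.2
  have hx' : ∀ i, ∃ z : ℤ, (z : ℝ) = (x : ι → ℝ) i := by
    have h5 := (Module.Basis.mem_span_iff_repr_mem ℤ b (x : ι → ℝ)).1 hx
    intro i
    simpa [hb] using h5 i
  choose z hz using hx'
  have hzx : (fun j => (z j : ℝ)) = (x : ι → ℝ) := funext hz
  refine ⟨z, ?_, ?_⟩
  · rintro rfl
    apply hx0
    apply Subtype.ext
    rw [← hzx]
    ext; simp
  · rw [hzx]; exact (hmem _).1 hxs

lemma distInt_nonneg (x : ℝ) : 0 ≤ distInt x := abs_nonneg _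

lemma distInt_le (x : ℝ) (z : ℤ) : distInt x ≤ |x - z| := round_le x z

lemma lower_bound {m : ℕ} (α : Fin m → ℝ)
    (h : 0 < Filter.liminf
      (fun n : ℕ => (n : ℝ) * ∏ i, distInt ((n : ℝ) * α i)) Filter.atTop) :
    ∃ a > (0 : ℝ), ∀ n : ℕ, 0 < n → a ≤ (n : ℝ) * ∏ i, distInt ((n : ℝ) * α i) := by
  set f : ℕ → ℝ := fun n => (n : ℝ) * ∏ i, distInt ((n : ℝ) * α i) with hf
  have h1 : ∃ a > (0 : ℝ), ∀ᶠ n in atTop, a ≤ f n := by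
    by_contra! hcon
    rw [Filter.liminf_eq] at h
    refine absurd h (not_lt.2 (Real.sSup_nonpos ?_))
    intro a ha
    by_contra! ha0
    exact hcon a ha0 (ha.mono fun n hn => not_lt.2 hn)
  obtain ⟨a, ha, hev⟩ := h1
  obtain ⟨M, hM⟩ := eventually_atTop.1 hev
  have hpos : ∀ n : ℕ, 0 < n → 0 < f n := by
    intro n hn
    refine mul_pos (by exact_mod_cast hn) (Finset.prod_pos fun i _ => ?_)
    refine lt_of_le_of_ne (distInt_nonneg _) fun h0 => ?_
    have h2 : (n : ℝ) * α i = round ((n : ℝ) * α i) := by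
      have := abs_eq_zero.1 h0.symm
      linarith
    have h3 := hM (M * n) (Nat.le_mul_of_pos_right _ hn)
    have h4 : distInt (((M * n : ℕ) : ℝ) * α i) = 0 := by
      refine le_antisymm ?_ (distInt_nonneg _)
      refine (distInt_le _ (M * round ((n : ℝ) * α i))).trans ?_
      push_cast
      rw [← h2]
      apply le_of_eq
      rw [abs_eq_zero]; ring
    have h5 : f (M * n) = 0 := by
      rw [hf]
      simp only
      rw [Finset.prod_eq_zero (Finset.mem_univ i) h4, mul_zero]
    linarith
  have h6 : ∀ K : ℕ, ∃ b > (0 : ℝ), ∀ n, 0 < n → n < K → b ≤ f n := by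
    intro K
    induction K with
    | zero => exact ⟨1, one_pos, fun n _ hn => by omega⟩
    | succ K ih =>
      obtain ⟨b, hb, hbn⟩ := ih
      rcases Nat.eq_zero_or_pos K with hK | hK
      · exact ⟨1, one_pos, fun n _ hn => by omega⟩
      · refine ⟨min b (f K), lt_min hb (hpos K hK), fun n hn hnK => ?_⟩
        rcases Nat.lt_succ_iff_lt_or_eq.1 hnK with h | h
        · exact (min_le_left _ _).trans (hbn n hn h)
        · rw [h]; exact min_le_right _ _
  obtain ⟨b, hb, hbn⟩ := h6 M
  refine ⟨min a b, lt_min ha hb, fun n hn => ?_⟩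
  rcases lt_or_ge n M with h | h
  · exact (min_le_right _ _).trans (hbn n hn h)
  · exact (min_le_left _ _).trans (hM n h)

lemma lower_bound_int {m : ℕ} (α : Fin m → ℝ) (a : ℝ)
    (h : ∀ n : ℕ, 0 < n → a ≤ (n : ℝ) * ∏ i, distInt ((n : ℝ) * α i))
    (n : ℤ) (hn : n ≠ 0) (p : Fin m → ℤ) :
    a ≤ |(n : ℝ)| * ∏ i, |(p i : ℝ) + n * α i| := by
  have h1 := h n.natAbs (Int.natAbs_pos.2 hn)
  have h2 : ((n.natAbs : ℕ) : ℝ) = |(n : ℝ)| := by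
    rw [Nat.cast_natAbs, Int.cast_abs]
  rw [h2] at h1
  refine h1.trans ?_
  refine mul_le_mul_of_nonneg_left ?_ (abs_nonneg _)
  refine Finset.prod_le_prod (fun i _ => distInt_nonneg _) fun i _ => ?_
  rcases abs_cases (n : ℝ) with ⟨h, _⟩ | ⟨h, _⟩
  · refine (distInt_le _ (-p i)).trans (le_of_eq ?_)
    rw [h]; push_cast; congr 1; ring
  · refine (distInt_le _ (p i)).trans (le_of_eq ?_)
    rw [h, ← abs_neg]; congr 1; ring

lemma transfer {m : ℕ} (α : Fin m → ℝ) (k : Fin m → ℤ) (q : ℤ) (δ : Fin m → ℝ)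
    (hδ : ∀ i, 0 < δ i) (hδ1 : ∀ i, δ i ≤ 1)
    (hL : (q : ℝ) - ∑ i, (k i : ℝ) * α i ≠ 0)
    (hd : |(q : ℝ) - ∑ i, (k i : ℝ) * α i| < ∏ i, δ i) :
    ∃ (n : ℤ) (p : Fin m → ℤ), n ≠ 0 ∧ (∀ i, |(p i : ℝ) + n * α i| < δ i) ∧
      |(n : ℝ)| * |(q : ℝ) - ∑ i, (k i : ℝ) * α i| ≤ ∑ i, |(k i : ℝ)| * δ i := by
  set A : Matrix (Fin m ⊕ Unit) (Fin m ⊕ Unit) ℝ :=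
    Matrix.fromBlocks 1 (Matrix.of fun i _ => α i) (Matrix.of fun _ j => (k j : ℝ))
      (Matrix.of fun _ _ => (q : ℝ)) with hA
  have hdet : A.det = (q : ℝ) - ∑ i, (k i : ℝ) * α i := by
    rw [hA, Matrix.det_fromBlocks_one₁₁, Matrix.det_unique, Matrix.sub_apply, Matrix.mul_apply]
    simp only [Matrix.of_apply]
  obtain ⟨z, hz0, hz⟩ := minkowski_forms A (by rwa [hdet]) (Sum.elim δ fun _ => 1)
    (by rintro (i | i) <;> simp [hδ]) (by simpa [hdet] using hd)
  have hx : ∀ i, |(z (Sum.inl i) : ℝ) + z (Sum.inr ()) * α i| < δ i := by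
    intro i
    have := hz (Sum.inl i)
    simpa [hA, Matrix.mulVec, dotProduct, Matrix.one_apply, mul_comm] using this
  have hl : |∑ i, (k i : ℝ) * z (Sum.inl i) + q * z (Sum.inr ())| < 1 := by
    have := hz (Sum.inr ())
    simpa [hA, Matrix.mulVec, dotProduct] using this
  have hl0 : ∑ i, (k i : ℝ) * z (Sum.inl i) + q * z (Sum.inr ()) = 0 := by
    have : |∑ i, k i * z (Sum.inl i) + q * z (Sum.inr ())| < 1 := by exact_mod_cast hl
    exact_mod_cast Int.abs_lt_one_iff.1 this
  refine ⟨z (Sum.inr ()), fun i => z (Sum.inl i), ?_, hx, ?_⟩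
  · intro h0
    apply hz0
    funext j
    rcases j with i | i
    · have h1 := (hx i).trans_le (hδ1 i)
      rw [h0] at h1
      have : |z (Sum.inl i)| < 1 := by
        have : |(z (Sum.inl i) : ℝ)| < 1 := by simpa using h1
        exact_mod_cast this
      exact Int.abs_lt_one_iff.1 this
    · exact h0
  · rw [← abs_mul]
    have h2 : (z (Sum.inr ()) : ℝ) * (q - ∑ i, (k i : ℝ) * α i) =
        -∑ i, (k i : ℝ) * (z (Sum.inl i) + z (Sum.inr ()) * α i) := by
      have : ∑ i, (k i : ℝ) * (z (Sum.inl i) + z (Sum.inr ()) * α i) =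
          ∑ i, (k i : ℝ) * z (Sum.inl i) + z (Sum.inr ()) * ∑ i, (k i : ℝ) * α i := by
        rw [Finset.mul_sum, ← Finset.sum_add_distrib]
        exact Finset.sum_congr rfl fun i _ => by ring
      rw [this]
      linear_combination hl0
    rw [h2, abs_neg]
    refine (Finset.abs_sum_le_sum_abs _ _).trans (Finset.sum_le_sum fun i _ => ?_)
    rw [abs_mul]
    exact mul_le_mul_of_nonneg_left (hx i).le (abs_nonneg _)

/-- If `m ≥ 1` and `liminf_{n→∞} n‖nα₁‖⋯‖nα_m‖ > 0`, then there is
`c > 0` such that for all positive integers `N₁,…,N_m` and all `n, n' ∈ ℤ^m` with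
`|nᵢ|, |n'ᵢ| ≤ Nᵢ`, if `Σ nᵢαᵢ` and `Σ n'ᵢαᵢ` are not congruent modulo `1`, then
`‖Σ (nᵢ − n'ᵢ)αᵢ‖ > c/(N₁⋯N_m)`. -/
theorem separation_of_values (m : ℕ) (hm : 1 ≤ m) (α : Fin m → ℝ)
    (h : 0 < Filter.liminf
      (fun n : ℕ => (n : ℝ) * ∏ i, distInt ((n : ℝ) * α i)) Filter.atTop) :
    ∃ c > (0 : ℝ), ∀ N : Fin m → ℕ, (∀ i, 0 < N i) →
      ∀ n n' : Fin m → ℤ, (∀ i, |n i| ≤ (N i : ℤ)) → (∀ i, |n' i| ≤ (N i : ℤ)) →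
      (¬ ∃ z : ℤ, (∑ i, (n i : ℝ) * α i) - (∑ i, (n' i : ℝ) * α i) = (z : ℝ)) →
      c / ∏ i, (N i : ℝ) < distInt (∑ i, ((n i - n' i : ℤ) : ℝ) * α i) := by
  obtain ⟨a, ha, hlow⟩ := lower_bound α h
  have hm0 : (0 : ℝ) < m := by exact_mod_cast hm
  set t₀ : ℝ := min 1 (a / (8 * m)) with ht₀
  have ht₀p : 0 < t₀ := lt_min one_pos (by positivity)
  refine ⟨t₀ ^ m / 2, by positivity, ?_⟩
  intro N hN n n' hn hn' hne
  by_contra! hcon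
  set k : Fin m → ℤ := fun i => n i - n' i with hk
  set S : ℝ := ∑ i, (k i : ℝ) * α i with hS
  set q : ℤ := round S with hq
  set L : ℝ := |(q : ℝ) - S| with hLdef
  have hSeq : S = (∑ i, (n i : ℝ) * α i) - (∑ i, (n' i : ℝ) * α i) := by
    rw [hS, ← Finset.sum_sub_distrib]
    refine Finset.sum_congr rfl fun i _ => ?_
    simp only [hk]; push_cast; ring
  have hLne : (q : ℝ) - S ≠ 0 := by
    intro h0
    exact hne ⟨q, by rw [← hSeq]; linarith⟩
  have hLp : 0 < L := abs_pos.2 hLne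
  have hNp : ∀ i, (0 : ℝ) < N i := fun i => by exact_mod_cast hN i
  have hN1 : ∀ i, (1 : ℝ) ≤ N i := fun i => by exact_mod_cast hN i
  set P : ℝ := ∏ i, (N i : ℝ) with hP
  have hPp : 0 < P := Finset.prod_pos fun i _ => hNp i
  have hLle : L ≤ t₀ ^ m / 2 / P := by
    have : distInt S = L := by rw [distInt, hLdef, abs_sub_comm]
    rw [← this]; exact hcon
  have hLP : 2 * L * P ≤ t₀ ^ m := by
    rw [le_div_iff₀ hPp] at hLle
    linarith
  set t : ℝ := (2 * L * P) ^ ((m : ℝ)⁻¹) with ht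
  have htp : 0 < t := Real.rpow_pos_of_pos (by positivity) _
  have htm : t ^ m = 2 * L * P := Real.rpow_inv_natCast_pow (by positivity) (by omega)
  have htt : t ≤ t₀ := le_of_pow_le_pow_left₀ (n := m) (by omega) ht₀p.le (by rw [htm]; exact hLP)
  have hprod : ∏ i, t / (N i : ℝ) = 2 * L := by
    rw [Finset.prod_div_distrib, Finset.prod_const, Finset.card_univ, Fintype.card_fin, htm, ← hP]
    field_simp
  obtain ⟨w, p, hw, hwp, hwL⟩ := transfer α k q (fun i => t / N i)
    (fun i => div_pos htp (hNp i))
    (fun i => by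
      rw [div_le_one (hNp i)]
      exact (htt.trans (min_le_left _ _)).trans (hN1 i))
    hLne (by rw [hprod, ← hS, ← hLdef]; linarith)
  rw [← hS, ← hLdef] at hwL
  have h1 := lower_bound_int α a hlow w hw p
  have h2 : ∏ i, |(p i : ℝ) + w * α i| ≤ 2 * L := by
    rw [← hprod]
    exact Finset.prod_le_prod (fun i _ => abs_nonneg _) fun i _ => (hwp i).le
  have h3 : ∑ i, |(k i : ℝ)| * (t / N i) ≤ m * (2 * t) := by
    have : ∀ i ∈ Finset.univ, |(k i : ℝ)| * (t / N i) ≤ 2 * t := by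
      intro i _
      have hki : |k i| ≤ 2 * (N i : ℤ) := by
        have := abs_sub (n i) (n' i)
        have h1 := hn i
        have h2 := hn' i
        simp only [hk]; linarith
      have hkr : |(k i : ℝ)| ≤ 2 * (N i : ℝ) := by exact_mod_cast hki
      rw [mul_div_assoc', div_le_iff₀ (hNp i)]
      nlinarith
    simpa using Finset.sum_le_card_nsmul _ _ _ this
  have h4 : a ≤ 4 * m * t := by
    have := mul_le_mul_of_nonneg_left h2 (abs_nonneg (w : ℝ))
    linarith
  have h5 : t ≤ a / (8 * m) := htt.trans (min_le_right _ _)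
  rw [le_div_iff₀ (by positivity)] at h5
  linarith
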